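/- Consider min{φ(x) = f(x) + h(x) : Ax = b} under the standing assumptions. Given λ ∈ ℝ^m and ρ > 0, let L_ρ(·,λ) be the augmented Lagrangian, M_ρ = L_f + ρ‖A‖², and 0 < η ≤ 1/M_ρ. Suppose x̃ ∈ dom h satisfies ‖G^η_{L_ρ(·,λ)}(x̃)‖ ≤ ε/2, and set x⁺ = x̃ − η·G^η_{L_ρ(·,λ)}(x̃) and λ⁺ = λ + ρ(Ax⁺ − b). Then there exists a subgradient v ∈ ∂_x L(·,λ⁺)(x⁺) with ‖v‖ ≤ ε. -/

import Mathlib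

noncomputable section

open Set
open scoped RealInnerProductSpace BigOperators

/-- `n`-dimensional Euclidean space. -/
abbrev Euc (k : ℕ) : Type := EuclideanSpace ℝ (Fin k)

variable {n m : ℕ}

/-- `f` is `μ`-strongly convex on the set `s` (with `μ = 0` this is convexity on `s`). -/
def SCOn (s : Set (Euc n)) (mu : ℝ) (f : Euc n → ℝ) : Prop :=
  ∀ ⦃x⦄, x ∈ s → ∀ ⦃y⦄, y ∈ s → ∀ ⦃a c : ℝ⦄, 0 ≤ a → 0 ≤ c → a + c = 1 →
    f (a • x + c • y) ≤ a * f x + c * f y - mu / 2 * (a * c) * ‖x - y‖ ^ 2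

/-- The convex subdifferential of `f` at `x` relative to the domain `s`
(`f` is interpreted as `+∞` outside of `s`). -/
def subdiffOn (s : Set (Euc n)) (f : Euc n → ℝ) (x : Euc n) : Set (Euc n) :=
  {v | ∀ y ∈ s, f x + ⟪v, y - x⟫ ≤ f y}

/-- `p = prox_{η h}(x)`, where `h` is interpreted as `+∞` outside of `s`. -/
def IsProxPt (s : Set (Euc n)) (h : Euc n → ℝ) (eta : ℝ) (x p : Euc n) : Prop :=
  p ∈ s ∧ ∀ ⦃y⦄, y ∈ s → eta * h p + ‖p - x‖ ^ 2 / 2 ≤ eta * h y + ‖y - x‖ ^ 2 / 2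

/-- `f` is differentiable with gradient `f'`, and `f'` is `L`-Lipschitz (i.e. `f` is `L`-smooth). -/
def HasLipGrad (f : Euc n → ℝ) (f' : Euc n → Euc n) (L : ℝ) : Prop :=
  (∀ x, HasGradientAt f (f' x) x) ∧ ∀ x y, ‖f' x - f' y‖ ≤ L * ‖x - y‖
/-!
STATEMENT 15 (Proposition: a small gradient mapping of the augmented Lagrangian yields a
small subgradient of the Lagrangian at the updated primal-dual pair).
`L_ρ(·,λ) = f + h + ⟪λ, A· - b⟫ + (ρ/2)‖A· - b‖²`; its smooth part has gradient
`u ↦ f'(u) + Aᵀλ + ρAᵀ(Au - b)` and smoothness constant `M_ρ = L_f + ρ‖A‖²`.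
-/

lemma aux_lim (c d : ℝ) (hd : 0 ≤ d) (H : ∀ t : ℝ, 0 < t → t ≤ 1 → 0 ≤ c + t * d) : 0 ≤ c := by
  by_contra hc
  push Not at hc
  have hpos : 0 < d - c := by linarith
  have h1 := H (-c / (d - c)) (div_pos (by linarith) hpos) (by rw [div_le_one hpos]; linarith)
  have h2 : c + -c / (d - c) * d = -(c * c) / (d - c) := by field_simp; ring
  rw [h2] at h1
  have : -(c * c) / (d - c) < 0 := div_neg_of_neg_of_pos (by nlinarith) hpos
  linarith

lemma aux_prox (s : Set (Euc n)) (h : Euc n → ℝ) (hh : ConvexOn ℝ s h) (eta : ℝ)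
    (heta : 0 < eta) (z p y : Euc n)
    (hp : IsProxPt s h eta z p) (hy : y ∈ s) : ⟪z - p, y - p⟫ ≤ eta * (h y - h p) := by
  have key := aux_lim (eta * (h y - h p) + ⟪p - z, y - p⟫) (‖y - p‖ ^ 2 / 2) (by positivity) (by
    intro t ht ht1
    have hw := hh.2 hp.1 hy (show 0 ≤ 1 - t by linarith) ht.le (by ring)
    have hws := hh.1 hp.1 hy (show 0 ≤ 1 - t by linarith) ht.le (by ring)
    have h1 := hp.2 hws
    have e : (1 - t) • p + t • y - z = (p - z) + t • (y - p) := by module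
    rw [e, norm_add_sq_real, norm_smul, inner_smul_right, mul_pow, Real.norm_eq_abs, sq_abs] at h1
    simp only [smul_eq_mul] at hw
    have h2 := mul_le_mul_of_nonneg_left hw heta.le
    have h3 : 0 ≤ t * (eta * (h y - h p) + ⟪p - z, y - p⟫ + t * (‖y - p‖ ^ 2 / 2)) := by
      linarith
    exact nonneg_of_mul_nonneg_right h3 ht)
  have e : ⟪z - p, y - p⟫ = -⟪p - z, y - p⟫ := by rw [← inner_neg_left, neg_sub]
  linarith

lemma aux_grad (f : Euc n → ℝ) (hf : ConvexOn ℝ Set.univ f) (g p y : Euc n)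
    (hg : HasGradientAt f g p) : f p + ⟪g, y - p⟫ ≤ f y := by
  have hc : ConvexOn ℝ Set.univ (f ∘ AffineMap.lineMap (k := ℝ) p y) := by
    simpa using hf.comp_affineMap (AffineMap.lineMap (k := ℝ) p y)
  have hd : HasDerivAt (f ∘ AffineMap.lineMap (k := ℝ) p y) ⟪g, y - p⟫ 0 := by
    have h1 : HasFDerivAt f ((InnerProductSpace.toDual ℝ _) g)
        (AffineMap.lineMap (k := ℝ) p y (0:ℝ)) := by
      simpa using hg.hasFDerivAt
    have h2 := h1.comp_hasDerivAt (0:ℝ) AffineMap.hasDerivAt_lineMap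
    simpa using h2
  have h3 := hc.le_slope_of_hasDerivAt (Set.mem_univ 0) (Set.mem_univ 1) one_pos hd
  simp [slope_def_field] at h3
  linarith

theorem lag_subgradient
    (domh : Set (Euc n)) (f h : Euc n → ℝ) (f' : Euc n → Euc n)
    (A : Euc n →L[ℝ] Euc m) (bvec : Euc m)
    (Lf rho eta eps : ℝ)
    (hfconv : ConvexOn ℝ Set.univ f)
    (hfsmooth : HasLipGrad f f' Lf)
    (hhconv : ConvexOn ℝ domh h) (hdomclosed : IsClosed domh)
    (hslater : ∃ xs ∈ intrinsicInterior ℝ domh, A xs = bvec)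
    (hbdd : Bornology.IsBounded domh)
    (hrho : 0 < rho) (heta0 : 0 < eta) (heta : eta ≤ 1 / (Lf + rho * ‖A‖ ^ 2))
    (heps : 0 < eps)
    (lam : Euc m) (xt p : Euc n) (hxt : xt ∈ domh)
    -- `p = prox_{ηh}(x̃ - η ∇Ψ(x̃))` where `Ψ` is the smooth part of `L_ρ(·,λ)`
    (hp : IsProxPt domh h eta
        (xt - eta • (f' xt + (ContinuousLinearMap.adjoint A) lam +
          rho • (ContinuousLinearMap.adjoint A) (A xt - bvec))) p)
    (G : Euc n) (hG : G = eta⁻¹ • (xt - p))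
    (hGsmall : ‖G‖ ≤ eps / 2)
    (xplus : Euc n) (hxplus : xplus = xt - eta • G)
    (lamplus : Euc m) (hlamplus : lamplus = lam + rho • (A xplus - bvec)) :
    ∃ v ∈ subdiffOn domh (fun u => f u + h u + ⟪lamplus, A u - bvec⟫) xplus,
      ‖v‖ ≤ eps := by
  have hpe : xplus = p := by
    rw [hxplus, hG, smul_inv_smul₀ heta0.ne']; abel
  subst hpe
  have hM : 0 < Lf + rho * ‖A‖ ^ 2 := one_div_pos.mp (heta0.trans_le heta)
  have hMe : (Lf + rho * ‖A‖ ^ 2) * eta ≤ 1 := by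
    rw [le_div_iff₀ hM] at heta; linarith
  have hx : xt - xplus = eta • G := by rw [hG, smul_inv_smul₀ heta0.ne']
  set B := ContinuousLinearMap.adjoint A with hB
  refine ⟨(f' xplus - f' xt) + rho • B (A (xplus - xt)) + G, ?_, ?_⟩
  · intro y hy
    have h1 := aux_prox domh h hhconv eta heta0 _ _ y hp hy
    have h2 := aux_grad f hfconv _ xplus y (hfsmooth.1 xplus)
    have e1 : xt - eta • (f' xt + B lam + rho • B (A xt - bvec)) - xplus
        = eta • (G - (f' xt + B lam + rho • B (A xt - bvec))) := by
      rw [smul_sub, ← hx]; abel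
    rw [e1, inner_smul_left] at h1
    have h3 := le_of_mul_le_mul_left h1 heta0
    have e2 : (f' xplus - f' xt) + rho • B (A (xplus - xt)) + G
        = f' xplus + B lamplus + (G - (f' xt + B lam + rho • B (A xt - bvec))) := by
      rw [hlamplus]; simp only [map_add, map_sub, map_smul]; module
    have e3 : ⟪B lamplus, y - xplus⟫ = ⟪lamplus, A y - bvec⟫ - ⟪lamplus, A xplus - bvec⟫ := by
      rw [hB, ContinuousLinearMap.adjoint_inner_left, ← inner_sub_right, map_sub]
      congr 1; abel
    rw [e2, inner_add_left, inner_add_left, e3]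
    dsimp only
    linarith
  · have hn : ‖xplus - xt‖ = eta * ‖G‖ := by
      rw [norm_sub_rev, hx, norm_smul, Real.norm_of_nonneg heta0.le]
    have h1 := hfsmooth.2 xplus xt
    have h2 : ‖rho • B (A (xplus - xt))‖ ≤ rho * ‖A‖ ^ 2 * ‖xplus - xt‖ := by
      rw [norm_smul, Real.norm_of_nonneg hrho.le, mul_assoc]
      have hBn : ‖B‖ = ‖A‖ := by rw [hB]; exact LinearIsometryEquiv.norm_map _ A
      have : ‖B (A (xplus - xt))‖ ≤ ‖A‖ ^ 2 * ‖xplus - xt‖ :=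
        calc _ ≤ ‖B‖ * ‖A (xplus - xt)‖ := B.le_opNorm _
          _ ≤ ‖A‖ * (‖A‖ * ‖xplus - xt‖) := by
            rw [hBn]; gcongr; exact A.le_opNorm _
          _ = _ := by ring
      gcongr
    have h3 := norm_add₃_le (a := f' xplus - f' xt) (b := rho • B (A (xplus - xt))) (c := G)
    have h4 := mul_le_mul_of_nonneg_right hMe (norm_nonneg G)
    rw [hn] at h1 h2
    linarith
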